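/- arXiv:1905.11976 — 3 statements merged into one kernel-verified Lean document; each statement's English description precedes it below -/
import Mathlib

section
/- (Covariant r-matrix structure for mKdV.) For all (q, r, q_x, r_x, q_xx, r_xx) ∈ ℂ⁶ and all λ, μ ∈ ℂ with λ ≠ μ, the mKdV Lax matrices satisfy the two 4×4 matrix identities {U₁(q,r;λ), U₂(q,r;μ)}_S = −[r₁₂(λ,μ), U(q,r;λ)⊗I + I⊗U(q,r;μ)] and {V₁(λ), V₂(μ)}_T = [r₁₂(λ,μ), V(λ)⊗I + I⊗V(μ)], where V(λ) = V(q,r,q_x,r_x,q_xx,r_xx;λ) and r₁₂ is the rational classical r-matrix. -/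
noncomputable section

open Matrix Kronecker

def σ3 : Matrix (Fin 2) (Fin 2) ℂ := !![1, 0; 0, -1]
def σp : Matrix (Fin 2) (Fin 2) ℂ := !![0, 1; 0, 0]
def σm : Matrix (Fin 2) (Fin 2) ℂ := !![0, 0; 1, 0]
def I2 : Matrix (Fin 2) (Fin 2) ℂ := 1

/-- ℂ⁶ with coordinates (q, r, q_x, r_x, q_xx, r_xx). -/
abbrev C6 := ℂ × ℂ × ℂ × ℂ × ℂ × ℂ

/-- AKNS space Lax matrix as a function of (q, r) ∈ ℂ². -/
def Uak (lam : ℂ) (w : ℂ × ℂ) : Matrix (Fin 2) (Fin 2) ℂ :=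
  (-(Complex.I * lam) / 2) • σ3 + w.1 • σp + w.2 • σm

/-- mKdV time Lax matrix as a function of (q, r, q_x, r_x, q_xx, r_xx) ∈ ℂ⁶. -/
def VmKdV (lam : ℂ) (w : C6) : Matrix (Fin 2) (Fin 2) ℂ :=
  (-lam ^ 3 / (2 * Complex.I) + Complex.I * lam * w.1 * w.2.1
      + w.2.2.2.1 * w.1 - w.2.2.1 * w.2.1) • σ3
    + (-lam ^ 2 * w.1 - Complex.I * lam * w.2.2.1 + w.2.2.2.2.1 - 2 * w.1 ^ 2 * w.2.1) • σp
    + (-lam ^ 2 * w.2.1 + Complex.I * lam * w.2.2.2.1 + w.2.2.2.2.2 - 2 * w.1 * w.2.1 ^ 2) • σm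

/-- single-time (space) Poisson bracket of functions of (q, r) ∈ ℂ². -/
def pbS (A C : ℂ × ℂ → ℂ) (p : ℂ × ℂ) : ℂ :=
  Complex.I * (fderiv ℂ A p (1, 0) * fderiv ℂ C p (0, 1)
    - fderiv ℂ C p (1, 0) * fderiv ℂ A p (0, 1))

/-- single-time (time) Poisson bracket of functions of (q, r, q_x, r_x, q_xx, r_xx) ∈ ℂ⁶ for mKdV. -/
def pbT (B D : C6 → ℂ) (p : C6) : ℂ :=
  Complex.I *
    (-(fderiv ℂ B p (1, 0, 0, 0, 0, 0) * fderiv ℂ D p (0, 0, 0, 0, 0, 1))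
      + fderiv ℂ D p (1, 0, 0, 0, 0, 0) * fderiv ℂ B p (0, 0, 0, 0, 0, 1)
      + fderiv ℂ B p (0, 1, 0, 0, 0, 0) * fderiv ℂ D p (0, 0, 0, 0, 1, 0)
      - fderiv ℂ D p (0, 1, 0, 0, 0, 0) * fderiv ℂ B p (0, 0, 0, 0, 1, 0)
      + fderiv ℂ B p (0, 0, 1, 0, 0, 0) * fderiv ℂ D p (0, 0, 0, 1, 0, 0)
      - fderiv ℂ D p (0, 0, 1, 0, 0, 0) * fderiv ℂ B p (0, 0, 0, 1, 0, 0)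
      - 6 * p.1 * p.2.1 * fderiv ℂ B p (0, 0, 0, 0, 1, 0) * fderiv ℂ D p (0, 0, 0, 0, 0, 1)
      + 6 * p.1 * p.2.1 * fderiv ℂ D p (0, 0, 0, 0, 1, 0) * fderiv ℂ B p (0, 0, 0, 0, 0, 1))

/-- {M₁, N₂}: 4×4 matrix whose ((i,k),(j,l)) entry is the bracket of M_{ij} with N_{kl}. -/
def matPBS (M N : ℂ × ℂ → Matrix (Fin 2) (Fin 2) ℂ) (p : ℂ × ℂ) :
    Matrix (Fin 2 × Fin 2) (Fin 2 × Fin 2) ℂ :=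
  Matrix.of fun ik jl => pbS (fun w => M w ik.1 jl.1) (fun w => N w ik.2 jl.2) p

def matPBT (M N : C6 → Matrix (Fin 2) (Fin 2) ℂ) (p : C6) :
    Matrix (Fin 2 × Fin 2) (Fin 2 × Fin 2) ℂ :=
  Matrix.of fun ik jl => pbT (fun w => M w ik.1 jl.1) (fun w => N w ik.2 jl.2) p

/-- rational classical r-matrix. -/
def rRat (lam mu : ℂ) : Matrix (Fin 2 × Fin 2) (Fin 2 × Fin 2) ℂ :=
  (1 / (mu - lam)) •
    (σp ⊗ₖ σm + σm ⊗ₖ σp + (1 / 2 : ℂ) • (σ3 ⊗ₖ σ3) + (1 / 2 : ℂ) • (I2 ⊗ₖ I2))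

/-- Directional derivatives of a differentiable function computed along a line. -/
lemma fderiv_line {E : Type*} [NormedAddCommGroup E] [NormedSpace ℂ E] (f : E → ℂ) (p v : E) (d : ℂ)
    (hf : DifferentiableAt ℂ f p) (hd : HasDerivAt (fun t : ℂ => f (p + t • v)) d 0) :
    fderiv ℂ f p v = d := by
  rw [← hf.lineDeriv_eq_fderiv]
  exact HasLineDerivAt.lineDeriv hd

/-- A polynomial in one variable, of degree at most three, has its linear coefficient as derivative
at zero. -/
lemma hasDerivAt_cubic (f : ℂ → ℂ) (a d b c : ℂ)
    (hf : ∀ t, f t = a + t * d + t ^ 2 * b + t ^ 3 * c) : HasDerivAt f d 0 := by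
  have : f = fun t => a + t * d + t ^ 2 * b + t ^ 3 * c := funext hf
  rw [this]
  have h1 := (hasDerivAt_id (0 : ℂ)).mul_const d
  have h2 := (hasDerivAt_pow 2 (0 : ℂ)).mul_const b
  have h3 := (hasDerivAt_pow 3 (0 : ℂ)).mul_const c
  have h4 := ((h1.const_add a).add h2).add h3
  refine h4.congr_deriv ?_
  simp

lemma fderiv_cubic {E : Type*} [NormedAddCommGroup E] [NormedSpace ℂ E] {f : E → ℂ} {p : E}
    (hf : DifferentiableAt ℂ f p) (v : E) (d b : ℂ)
    (h : ∀ t : ℂ, f (p + t • v) = f p + t * d + t ^ 2 * b) :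
    fderiv ℂ f p v = d :=
  fderiv_line f p v d hf (hasDerivAt_cubic _ (f p) d b 0 (by intro t; rw [h]; ring))

lemma U00 (l : ℂ) (w : ℂ × ℂ) : Uak l w 0 0 = -(Complex.I * l) / 2 := by
  simp [Uak, σ3, σp, σm]
lemma U11 (l : ℂ) (w : ℂ × ℂ) : Uak l w 1 1 = Complex.I * l / 2 := by
  simp [Uak, σ3, σp, σm]; ring
lemma U01 (l : ℂ) (w : ℂ × ℂ) : Uak l w 0 1 = w.1 := by
  simp [Uak, σ3, σp, σm]
lemma U10 (l : ℂ) (w : ℂ × ℂ) : Uak l w 1 0 = w.2 := by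
  simp [Uak, σ3, σp, σm]

/-- Diagonal coefficient of V. -/
def va (l : ℂ) (w : C6) : ℂ := Complex.I * l ^ 3 / 2 + Complex.I * l * w.1 * w.2.1
      + w.2.2.2.1 * w.1 - w.2.2.1 * w.2.1
/-- Upper coefficient of V. -/
def vb (l : ℂ) (w : C6) : ℂ :=
  -l ^ 2 * w.1 - Complex.I * l * w.2.2.1 + w.2.2.2.2.1 - 2 * w.1 ^ 2 * w.2.1
/-- Lower coefficient of V. -/
def vc (l : ℂ) (w : C6) : ℂ :=
  -l ^ 2 * w.2.1 + Complex.I * l * w.2.2.2.1 + w.2.2.2.2.2 - 2 * w.1 * w.2.1 ^ 2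

lemma coefI (l : ℂ) : -l ^ 3 / (2 * Complex.I) = Complex.I * l ^ 3 / 2 := by
  rw [div_eq_div_iff (by simp) (by simp)]
  linear_combination (-2 * l ^ 3) * Complex.I_mul_I

lemma V00 (l : ℂ) (w : C6) : VmKdV l w 0 0 = va l w := by
  simp only [VmKdV, coefI]; simp [va, σ3, σp, σm]
lemma V11 (l : ℂ) (w : C6) : VmKdV l w 1 1 = -va l w := by
  simp only [VmKdV, coefI]; simp [va, σ3, σp, σm]
lemma V01 (l : ℂ) (w : C6) : VmKdV l w 0 1 = vb l w := by
  simp [VmKdV, vb, σ3, σp, σm]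
lemma V10 (l : ℂ) (w : C6) : VmKdV l w 1 0 = vc l w := by
  simp [VmKdV, vc, σ3, σp, σm]

lemma va_diff (l : ℂ) (p : C6) : DifferentiableAt ℂ (va l) p := by unfold va; fun_prop
lemma vb_diff (l : ℂ) (p : C6) : DifferentiableAt ℂ (vb l) p := by unfold vb; fun_prop
lemma vc_diff (l : ℂ) (p : C6) : DifferentiableAt ℂ (vc l) p := by unfold vc; fun_prop

lemma va_fderiv (l q r qx rx qxx rxx : ℂ) :
    fderiv ℂ (va l) (q, r, qx, rx, qxx, rxx) (1, 0, 0, 0, 0, 0) = Complex.I * l * r + rx ∧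
    fderiv ℂ (va l) (q, r, qx, rx, qxx, rxx) (0, 1, 0, 0, 0, 0) = Complex.I * l * q - qx ∧
    fderiv ℂ (va l) (q, r, qx, rx, qxx, rxx) (0, 0, 1, 0, 0, 0) = -r ∧
    fderiv ℂ (va l) (q, r, qx, rx, qxx, rxx) (0, 0, 0, 1, 0, 0) = q ∧
    fderiv ℂ (va l) (q, r, qx, rx, qxx, rxx) (0, 0, 0, 0, 1, 0) = 0 ∧
    fderiv ℂ (va l) (q, r, qx, rx, qxx, rxx) (0, 0, 0, 0, 0, 1) = 0 := by
  refine ⟨?_, ?_, ?_, ?_, ?_, ?_⟩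
  · refine fderiv_cubic (va_diff l _) _ _ (0) fun t => ?_
    simp [va]; try ring
  · refine fderiv_cubic (va_diff l _) _ _ (0) fun t => ?_
    simp [va]; try ring
  · refine fderiv_cubic (va_diff l _) _ _ (0) fun t => ?_
    simp [va]; try ring
  · refine fderiv_cubic (va_diff l _) _ _ (0) fun t => ?_
    simp [va]; try ring
  · refine fderiv_cubic (va_diff l _) _ _ (0) fun t => ?_
    simp [va]; try ring
  · refine fderiv_cubic (va_diff l _) _ _ (0) fun t => ?_
    simp [va]; try ring

lemma vb_fderiv (l q r qx rx qxx rxx : ℂ) :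
    fderiv ℂ (vb l) (q, r, qx, rx, qxx, rxx) (1, 0, 0, 0, 0, 0) = -l ^ 2 - 4 * q * r ∧
    fderiv ℂ (vb l) (q, r, qx, rx, qxx, rxx) (0, 1, 0, 0, 0, 0) = -2 * q ^ 2 ∧
    fderiv ℂ (vb l) (q, r, qx, rx, qxx, rxx) (0, 0, 1, 0, 0, 0) = -Complex.I * l ∧
    fderiv ℂ (vb l) (q, r, qx, rx, qxx, rxx) (0, 0, 0, 1, 0, 0) = 0 ∧
    fderiv ℂ (vb l) (q, r, qx, rx, qxx, rxx) (0, 0, 0, 0, 1, 0) = 1 ∧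
    fderiv ℂ (vb l) (q, r, qx, rx, qxx, rxx) (0, 0, 0, 0, 0, 1) = 0 := by
  refine ⟨?_, ?_, ?_, ?_, ?_, ?_⟩
  · refine fderiv_cubic (vb_diff l _) _ _ (-2 * r) fun t => ?_
    simp [vb]; try ring
  · refine fderiv_cubic (vb_diff l _) _ _ (0) fun t => ?_
    simp [vb]; try ring
  · refine fderiv_cubic (vb_diff l _) _ _ (0) fun t => ?_
    simp [vb]; try ring
  · refine fderiv_cubic (vb_diff l _) _ _ (0) fun t => ?_
    simp [vb]; try ring
  · refine fderiv_cubic (vb_diff l _) _ _ (0) fun t => ?_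
    simp [vb]; try ring
  · refine fderiv_cubic (vb_diff l _) _ _ (0) fun t => ?_
    simp [vb]; try ring

lemma vc_fderiv (l q r qx rx qxx rxx : ℂ) :
    fderiv ℂ (vc l) (q, r, qx, rx, qxx, rxx) (1, 0, 0, 0, 0, 0) = -2 * r ^ 2 ∧
    fderiv ℂ (vc l) (q, r, qx, rx, qxx, rxx) (0, 1, 0, 0, 0, 0) = -l ^ 2 - 4 * q * r ∧
    fderiv ℂ (vc l) (q, r, qx, rx, qxx, rxx) (0, 0, 1, 0, 0, 0) = 0 ∧
    fderiv ℂ (vc l) (q, r, qx, rx, qxx, rxx) (0, 0, 0, 1, 0, 0) = Complex.I * l ∧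
    fderiv ℂ (vc l) (q, r, qx, rx, qxx, rxx) (0, 0, 0, 0, 1, 0) = 0 ∧
    fderiv ℂ (vc l) (q, r, qx, rx, qxx, rxx) (0, 0, 0, 0, 0, 1) = 1 := by
  refine ⟨?_, ?_, ?_, ?_, ?_, ?_⟩
  · refine fderiv_cubic (vc_diff l _) _ _ (0) fun t => ?_
    simp [vc]; try ring
  · refine fderiv_cubic (vc_diff l _) _ _ (-2 * q) fun t => ?_
    simp [vc]; try ring
  · refine fderiv_cubic (vc_diff l _) _ _ (0) fun t => ?_
    simp [vc]; try ring
  · refine fderiv_cubic (vc_diff l _) _ _ (0) fun t => ?_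
    simp [vc]; try ring
  · refine fderiv_cubic (vc_diff l _) _ _ (0) fun t => ?_
    simp [vc]; try ring
  · refine fderiv_cubic (vc_diff l _) _ _ (0) fun t => ?_
    simp [vc]; try ring

lemma U_fderiv (p v : ℂ × ℂ) : fderiv ℂ (fun w : ℂ × ℂ => w.1) p v = v.1 ∧
    fderiv ℂ (fun w : ℂ × ℂ => w.2) p v = v.2 := by
  constructor
  · exact congrArg (fun L => L v) (hasFDerivAt_fst (𝕜 := ℂ) (p := p)).fderiv
  · exact congrArg (fun L => L v) (hasFDerivAt_snd (𝕜 := ℂ) (p := p)).fderiv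

set_option linter.all false
set_option linter.unusedSimpArgs false
set_option maxHeartbeats 8000000 in
/-- Covariant r-matrix structure for mKdV. -/
theorem covariant_r_matrix_mKdV (q r qx rx qxx rxx : ℂ) (lam mu : ℂ) (h : lam ≠ mu) :
    matPBS (Uak lam) (Uak mu) (q, r)
      = -(rRat lam mu * (Uak lam (q, r) ⊗ₖ I2 + I2 ⊗ₖ Uak mu (q, r))
          - (Uak lam (q, r) ⊗ₖ I2 + I2 ⊗ₖ Uak mu (q, r)) * rRat lam mu)
    ∧ matPBT (VmKdV lam) (VmKdV mu) (q, r, qx, rx, qxx, rxx)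
      = rRat lam mu
            * (VmKdV lam (q, r, qx, rx, qxx, rxx) ⊗ₖ I2
                + I2 ⊗ₖ VmKdV mu (q, r, qx, rx, qxx, rxx))
          - (VmKdV lam (q, r, qx, rx, qxx, rxx) ⊗ₖ I2
                + I2 ⊗ₖ VmKdV mu (q, r, qx, rx, qxx, rxx)) * rRat lam mu := by
  have hml : mu - lam ≠ 0 := sub_ne_zero.mpr h.symm
  have hI : Complex.I ^ 2 = -1 := Complex.I_sq
  constructor
  · ext ⟨i, k⟩ ⟨j, l⟩
    fin_cases i <;> fin_cases k <;> fin_cases j <;> fin_cases l <;>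
      simp [matPBS, pbS, rRat, Matrix.mul_apply, Fintype.sum_prod_type, U00, U01, U10, U11, I2,
        σ3, σp, σm, (U_fderiv _ _).1, (U_fderiv _ _).2] <;> field_simp <;> ring
  · obtain ⟨a1, a2, a3, a4, a5, a6⟩ := va_fderiv lam q r qx rx qxx rxx
    obtain ⟨b1, b2, b3, b4, b5, b6⟩ := vb_fderiv lam q r qx rx qxx rxx
    obtain ⟨c1, c2, c3, c4, c5, c6⟩ := vc_fderiv lam q r qx rx qxx rxx
    obtain ⟨d1, d2, d3, d4, d5, d6⟩ := va_fderiv mu q r qx rx qxx rxx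
    obtain ⟨e1, e2, e3, e4, e5, e6⟩ := vb_fderiv mu q r qx rx qxx rxx
    obtain ⟨f1, f2, f3, f4, f5, f6⟩ := vc_fderiv mu q r qx rx qxx rxx
    have hn : ∀ l p v, fderiv ℂ (fun w => -va l w) p v = -fderiv ℂ (va l) p v := by
      intro l p v
      rw [fderiv_fun_neg]; rfl
    ext ⟨i, k⟩ ⟨j, l⟩
    fin_cases i <;> fin_cases k <;> fin_cases j <;> fin_cases l <;>
      simp [matPBT, pbT, rRat, Matrix.mul_apply, Fintype.sum_prod_type, V00, V01, V10, V11, I2,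
        σ3, σp, σm, hn, a1, a2, a3, a4, a5, a6, b1, b2, b3, b4, b5, b6, c1, c2, c3, c4, c5, c6,
        d1, d2, d3, d4, d5, d6, e1, e2, e3, e4, e5, e6, f1, f2, f3, f4, f5, f6] <;>
      (try simp only [va, vb, vc]) <;> field_simp <;> ring_nf <;> (try simp only [hI, Complex.I_pow_three, Complex.I_sq]) <;> (try ring)
end
end

section
/- (Dual Sklyanin relation for the mKdV time Lax matrix.) For all (q, r, q_x, r_x, q_xx, r_xx) ∈ ℂ⁶ and all λ, μ ∈ ℂ with λ ≠ μ, the 4×4 matrix identity {V₁(λ), V₂(μ)}_T = [r₁₂(λ,μ), V(λ)⊗I + I⊗V(μ)] holds, where V(λ) = V(q,r,q_x,r_x,q_xx,r_xx;λ) is the mKdV time Lax matrix and r₁₂ is the rational classical r-matrix. -/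
noncomputable section

open Matrix Kronecker

/-- The diagonal coefficient and its derivative along a direction. -/
lemma fderiv_a (lam : ℂ) (p v : C6) :
    fderiv ℂ (fun w : C6 => -lam ^ 3 / (2 * Complex.I) + Complex.I * lam * w.1 * w.2.1
      + w.2.2.2.1 * w.1 - w.2.2.1 * w.2.1) p v
    = (Complex.I * lam * p.2.1 + p.2.2.2.1) * v.1 + (Complex.I * lam * p.1 - p.2.2.1) * v.2.1
      - p.2.1 * v.2.2.1 + p.1 * v.2.2.2.1 := by
  have h1 : HasFDerivAt (fun w : C6 => w.1) _ p := hasFDerivAt_fst (𝕜 := ℂ)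
  have h2 : HasFDerivAt (fun w : C6 => w.2.1) _ p := (hasFDerivAt_snd (𝕜 := ℂ) (p := p)).fst
  have h3 : HasFDerivAt (fun w : C6 => w.2.2.1) _ p := (hasFDerivAt_snd (𝕜 := ℂ) (p := p)).snd.fst
  have h4 : HasFDerivAt (fun w : C6 => w.2.2.2.1) _ p := (hasFDerivAt_snd (𝕜 := ℂ) (p := p)).snd.snd.fst
  have H := ((((h1.const_mul (Complex.I * lam)).mul h2).const_add
    (-lam ^ 3 / (2 * Complex.I))).add (h4.mul h1)).sub (h3.mul h2)
  refine (congrArg (fun L => L v) H.fderiv).trans ?_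
  simp
  ring

lemma fderiv_b (lam : ℂ) (p v : C6) :
    fderiv ℂ (fun w : C6 => -lam ^ 2 * w.1 - Complex.I * lam * w.2.2.1 + w.2.2.2.2.1
      - 2 * w.1 ^ 2 * w.2.1) p v
    = (-lam ^ 2 - 4 * p.1 * p.2.1) * v.1 - 2 * p.1 ^ 2 * v.2.1
      - Complex.I * lam * v.2.2.1 + v.2.2.2.2.1 := by
  have h1 : HasFDerivAt (fun w : C6 => w.1) _ p := hasFDerivAt_fst (𝕜 := ℂ)
  have h2 : HasFDerivAt (fun w : C6 => w.2.1) _ p := (hasFDerivAt_snd (𝕜 := ℂ) (p := p)).fst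
  have h3 : HasFDerivAt (fun w : C6 => w.2.2.1) _ p := (hasFDerivAt_snd (𝕜 := ℂ) (p := p)).snd.fst
  have h5 : HasFDerivAt (fun w : C6 => w.2.2.2.2.1) _ p :=
    (hasFDerivAt_snd (𝕜 := ℂ) (p := p)).snd.snd.snd.fst
  have H := (((h1.const_mul (-lam ^ 2)).sub (h3.const_mul (Complex.I * lam))).add h5).sub
    (((h1.pow 2).const_mul 2).mul h2)
  refine (congrArg (fun L => L v) H.fderiv).trans ?_
  simp
  ring

lemma fderiv_c (lam : ℂ) (p v : C6) :
    fderiv ℂ (fun w : C6 => -lam ^ 2 * w.2.1 + Complex.I * lam * w.2.2.2.1 + w.2.2.2.2.2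
      - 2 * w.1 * w.2.1 ^ 2) p v
    = (-lam ^ 2 - 4 * p.1 * p.2.1) * v.2.1 - 2 * p.2.1 ^ 2 * v.1
      + Complex.I * lam * v.2.2.2.1 + v.2.2.2.2.2 := by
  have h1 : HasFDerivAt (fun w : C6 => w.1) _ p := hasFDerivAt_fst (𝕜 := ℂ)
  have h2 : HasFDerivAt (fun w : C6 => w.2.1) _ p := (hasFDerivAt_snd (𝕜 := ℂ) (p := p)).fst
  have h4 : HasFDerivAt (fun w : C6 => w.2.2.2.1) _ p := (hasFDerivAt_snd (𝕜 := ℂ) (p := p)).snd.snd.fst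
  have h6 : HasFDerivAt (fun w : C6 => w.2.2.2.2.2) _ p :=
    (hasFDerivAt_snd (𝕜 := ℂ) (p := p)).snd.snd.snd.snd
  have H := (((h2.const_mul (-lam ^ 2)).add (h4.const_mul (Complex.I * lam))).add h6).sub
    ((h1.const_mul 2).mul (h2.pow 2))
  refine (congrArg (fun L => L v) H.fderiv).trans ?_
  simp
  ring

lemma V00_s10 (lam : ℂ) (w : C6) : VmKdV lam w 0 0 = -lam ^ 3 / (2 * Complex.I)
    + Complex.I * lam * w.1 * w.2.1 + w.2.2.2.1 * w.1 - w.2.2.1 * w.2.1 := by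
  simp [VmKdV, σ3, σp, σm]

lemma V11_s10 (lam : ℂ) (w : C6) : VmKdV lam w 1 1 = -(-lam ^ 3 / (2 * Complex.I)
    + Complex.I * lam * w.1 * w.2.1 + w.2.2.2.1 * w.1 - w.2.2.1 * w.2.1) := by
  simp [VmKdV, σ3, σp, σm]

lemma V01_s10 (lam : ℂ) (w : C6) : VmKdV lam w 0 1 = -lam ^ 2 * w.1 - Complex.I * lam * w.2.2.1
    + w.2.2.2.2.1 - 2 * w.1 ^ 2 * w.2.1 := by
  simp [VmKdV, σ3, σp, σm]

lemma V10_s10 (lam : ℂ) (w : C6) : VmKdV lam w 1 0 = -lam ^ 2 * w.2.1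
    + Complex.I * lam * w.2.2.2.1 + w.2.2.2.2.2 - 2 * w.1 * w.2.1 ^ 2 := by
  simp [VmKdV, σ3, σp, σm]

lemma fderiv_a_neg (lam : ℂ) (p v : C6) :
    fderiv ℂ (fun w : C6 => -(-lam ^ 3 / (2 * Complex.I) + Complex.I * lam * w.1 * w.2.1
      + w.2.2.2.1 * w.1 - w.2.2.1 * w.2.1)) p v
    = -((Complex.I * lam * p.2.1 + p.2.2.2.1) * v.1 + (Complex.I * lam * p.1 - p.2.2.1) * v.2.1
      - p.2.1 * v.2.2.1 + p.1 * v.2.2.2.1) := by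
  rw [fderiv_fun_neg, ← fderiv_a]
  rfl

set_option maxHeartbeats 4000000 in
/-- Dual Sklyanin relation for the mKdV time Lax matrix. -/
theorem sklyanin_mKdV_V (q r qx rx qxx rxx : ℂ) (lam mu : ℂ) (h : lam ≠ mu) :
    matPBT (VmKdV lam) (VmKdV mu) (q, r, qx, rx, qxx, rxx)
      = rRat lam mu
            * (VmKdV lam (q, r, qx, rx, qxx, rxx) ⊗ₖ I2
                + I2 ⊗ₖ VmKdV mu (q, r, qx, rx, qxx, rxx))
          - (VmKdV lam (q, r, qx, rx, qxx, rxx) ⊗ₖ I2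
                + I2 ⊗ₖ VmKdV mu (q, r, qx, rx, qxx, rxx)) * rRat lam mu := by
  have hne : mu - lam ≠ 0 := sub_ne_zero.mpr (Ne.symm h)
  have hI : Complex.I ^ 2 = -1 := Complex.I_sq
  have hinv : ∀ x : ℂ, x / (2 * Complex.I) = -(Complex.I * x / 2) := by
    intro x
    field_simp
    linear_combination x * hI
  ext ⟨i, k⟩ ⟨j, l⟩
  fin_cases i <;> fin_cases k <;> fin_cases j <;> fin_cases l <;>
    simp only [matPBT, pbT, Matrix.of_apply, Fin.zero_eta, Fin.mk_one, V00_s10, V01_s10, V10_s10, V11_s10,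
      fderiv_a, fderiv_a_neg, fderiv_b, fderiv_c, Matrix.sub_apply, Matrix.mul_apply,
      Fintype.sum_prod_type, Fin.sum_univ_two, Matrix.add_apply, Matrix.kroneckerMap_apply,
      rRat, Matrix.smul_apply, smul_eq_mul] <;>
    simp [σ3, σp, σm, I2, hinv] <;> field_simp <;> ring_nf <;> simp only [hI] <;> ring_nf
end
end

section
/- (Component Poisson brackets for the mKdV time Lax matrix.) Write V = V³σ₃ + V⁺σ₊ + V⁻σ₋ for the mKdV time Lax matrix, i.e. V³(λ) = −λ³/(2i) + iλqr + r_x q − q_x r, V⁺(λ) = −λ²q − iλq_x + q_xx − 2q²r, V⁻(λ) = −λ²r + iλr_x + r_xx − 2qr². Then for all (q, r, q_x, r_x, q_xx, r_xx) ∈ ℂ⁶ and all λ, μ ∈ ℂ: {V⁺(λ),V⁻(μ)}_T = i(2qr + μ² + λμ + λ²), {V⁻(λ),V⁺(μ)}_T = −i(2qr + μ² + λμ + λ²), {V⁺(λ),V³(μ)}_T = q(λ+μ) + iq_x, {V⁻(λ),V³(μ)}_T = −r(λ+μ) + ir_x, {V³(λ),V⁺(μ)}_T = −(q(λ+μ)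 + iq_x), {V³(λ),V⁻(μ)}_T = r(λ+μ) − ir_x, and {V³(λ),V³(μ)}_T = {V⁺(λ),V⁺(μ)}_T = {V⁻(λ),V⁻(μ)}_T = 0. -/
noncomputable section

open Matrix

/-- components (V³, V⁺, V⁻) of the mKdV time Lax matrix,
as functions of (q, r, q_x, r_x, q_xx, r_xx) ∈ ℂ⁶. -/
def Vcomp (lam : ℂ) : Fin 3 → C6 → ℂ :=
  ![fun w => -lam ^ 3 / (2 * Complex.I) + Complex.I * lam * w.1 * w.2.1
        + w.2.2.2.1 * w.1 - w.2.2.1 * w.2.1,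
    fun w => -lam ^ 2 * w.1 - Complex.I * lam * w.2.2.1 + w.2.2.2.2.1 - 2 * w.1 ^ 2 * w.2.1,
    fun w => -lam ^ 2 * w.2.1 + Complex.I * lam * w.2.2.2.1 + w.2.2.2.2.2 - 2 * w.1 * w.2.1 ^ 2]

/-- Full derivatives of the components, evaluated on a tangent vector `v`. -/
lemma fderiv_V3 (lam : ℂ) (p v : C6) : fderiv ℂ (Vcomp lam 0) p v =
    Complex.I * lam * (v.1 * p.2.1 + p.1 * v.2.1)
      + (v.2.2.2.1 * p.1 + p.2.2.2.1 * v.1) - (v.2.2.1 * p.2.1 + p.2.2.1 * v.2.1) := by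
  have h1 : HasFDerivAt (fun w : C6 => w.1) (ContinuousLinearMap.fst ℂ _ _) p := hasFDerivAt_fst
  have t1 : HasFDerivAt (fun w : C6 => w.2) (ContinuousLinearMap.snd ℂ _ _) p := hasFDerivAt_snd
  have h2 := t1.fst
  have h3 := t1.snd.fst
  have h4 := t1.snd.snd.fst
  have h := (((((h1.const_mul (Complex.I * lam)).mul h2).const_add
    (-lam ^ 3 / (2 * Complex.I))).add (h4.mul h1)).sub (h3.mul h2))
  have e : fderiv ℂ (Vcomp lam 0) p = _ := h.fderiv
  rw [e]
  simp
  ring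

lemma fderiv_Vp (lam : ℂ) (p v : C6) : fderiv ℂ (Vcomp lam 1) p v =
    -lam ^ 2 * v.1 - Complex.I * lam * v.2.2.1 + v.2.2.2.2.1
      - (4 * p.1 * p.2.1 * v.1 + 2 * p.1 ^ 2 * v.2.1) := by
  have h1 : HasFDerivAt (fun w : C6 => w.1) (ContinuousLinearMap.fst ℂ _ _) p := hasFDerivAt_fst
  have t1 : HasFDerivAt (fun w : C6 => w.2) (ContinuousLinearMap.snd ℂ _ _) p := hasFDerivAt_snd
  have h2 := t1.fst
  have h3 := t1.snd.fst
  have h5 := t1.snd.snd.snd.fst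
  have h := (((h1.const_mul (-lam ^ 2)).sub (h3.const_mul (Complex.I * lam))).add h5).sub
    (((h1.pow 2).const_mul 2).mul h2)
  have e : fderiv ℂ (Vcomp lam 1) p = _ := h.fderiv
  rw [e]
  simp
  ring

lemma fderiv_Vm (lam : ℂ) (p v : C6) : fderiv ℂ (Vcomp lam 2) p v =
    -lam ^ 2 * v.2.1 + Complex.I * lam * v.2.2.2.1 + v.2.2.2.2.2
      - (2 * p.2.1 ^ 2 * v.1 + 4 * p.1 * p.2.1 * v.2.1) := by
  have h1 : HasFDerivAt (fun w : C6 => w.1) (ContinuousLinearMap.fst ℂ _ _) p := hasFDerivAt_fst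
  have t1 : HasFDerivAt (fun w : C6 => w.2) (ContinuousLinearMap.snd ℂ _ _) p := hasFDerivAt_snd
  have h2 := t1.fst
  have h4 := t1.snd.snd.fst
  have h6 := t1.snd.snd.snd.snd
  have h := (((h2.const_mul (-lam ^ 2)).add (h4.const_mul (Complex.I * lam))).add h6).sub
    ((h1.const_mul 2).mul (h2.pow 2))
  have e : fderiv ℂ (Vcomp lam 2) p = _ := h.fderiv
  rw [e]
  simp
  ring

/-- Component Poisson brackets for the mKdV time Lax matrix: the full table
{Vᵃ(λ), Vᵇ(μ)}_T with a, b ∈ {3, +, −}. -/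
theorem component_brackets_mKdV (q r qx rx qxx rxx : ℂ) (lam mu : ℂ) :
    (Matrix.of fun a b : Fin 3 =>
        pbT (Vcomp lam a) (Vcomp mu b) (q, r, qx, rx, qxx, rxx))
      = !![0, -(q * (lam + mu) + Complex.I * qx), r * (lam + mu) - Complex.I * rx;
           q * (lam + mu) + Complex.I * qx, 0,
             Complex.I * (2 * q * r + mu ^ 2 + lam * mu + lam ^ 2);
           -r * (lam + mu) + Complex.I * rx,
             -(Complex.I * (2 * q * r + mu ^ 2 + lam * mu + lam ^ 2)), 0] := by
  have hI : Complex.I ^ 2 = -1 := Complex.I_sq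
  ext a b
  fin_cases a <;> fin_cases b <;>
    simp [pbT, fderiv_V3, fderiv_Vp, fderiv_Vm] <;> grind
end
end
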